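/- Let |G⟩ be an n-qubit graph state with stabilizer S, let d ≥ 1, let g_1, …, g_s be independent generators of the subgroup S_d of S generated by all elements of weight at most d (s = log₂|S_d|), and extend to an independent generating set g_1, …, g_n of S. For γ = (γ_{s+1},…,γ_n) ∈ {0,1}^{n−s}, let |G;γ⟩ be the stabilizer state whose stabilizer is generated by g_1, …, g_s, (−1)^{γ_{s+1}} g_{s+1}, …, (−1)^{γ_n} g_n. Then for every n-qubit Pauli operator τ with wt(τ) ≤ d one has ⟨G|τ|G⟩ = ⟨G;γ|τ|G;γ⟩. -/

import Mathlib

open Matrix BigOperators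
open scoped Classical

noncomputable section

/-- The state space of `n` qubits, `(ℂ²)^{⊗n}`, realized as functions from bit strings to `ℂ`. -/
abbrev QState (n : ℕ) : Type := (Fin n → Fin 2) → ℂ

/-- Operators on `n` qubits. -/
abbrev QOp (n : ℕ) : Type := Matrix (Fin n → Fin 2) (Fin n → Fin 2) ℂ

/-- The single qubit Pauli matrices: `0 ↦ σ₀ = I`, `1 ↦ σ_x`, `2 ↦ σ_y`, `3 ↦ σ_z`. -/
def pauli1 (k : Fin 4) : Matrix (Fin 2) (Fin 2) ℂ :=
  if k = 0 then 1
  else if k = 1 then !![0, 1; 1, 0]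
  else if k = 2 then !![0, -Complex.I; Complex.I, 0]
  else !![1, 0; 0, -1]

/-- The `n`-qubit Pauli operator `σ_{f 0} ⊗ σ_{f 1} ⊗ ⋯ ⊗ σ_{f (n-1)}`. -/
def pauliOp {n : ℕ} (f : Fin n → Fin 4) : QOp n :=
  Matrix.of fun v w => ∏ i, pauli1 (f i) (v i) (w i)

/-- The support of a Pauli operator: the qubits on which it acts nontrivially. -/
def pSupport {n : ℕ} (f : Fin n → Fin 4) : Finset (Fin n) :=
  Finset.univ.filter fun i => f i ≠ 0

/-- The weight of a Pauli operator: the number of qubits on which it acts nontrivially. -/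
def pWeight {n : ℕ} (f : Fin n → Fin 4) : ℕ := (pSupport f).card

/-- `g` is the signed Pauli operator `±σ_f`. -/
def IsSignedPauli {n : ℕ} (g : QOp n) (f : Fin n → Fin 4) : Prop :=
  g = pauliOp f ∨ g = -pauliOp f

/-- The squared norm `∑_v |ψ_v|²` of an `n`-qubit state. -/
def qNormSq {n : ℕ} (ψ : QState n) : ℝ := ∑ v, Complex.normSq (ψ v)

/-- The inner product `⟨φ|ψ⟩` (antilinear in the first argument). -/
def qInner {n : ℕ} (φ ψ : QState n) : ℂ := ∑ v, starRingEnd ℂ (φ v) * ψ v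

/-- The graph state correlation operator `K_a = σ_x^(a) ∏_{b ∈ N(a)} σ_z^(b)`. -/
def Kop {n : ℕ} (G : SimpleGraph (Fin n)) [DecidableRel G.Adj] (a : Fin n) : QOp n :=
  pauliOp fun b => if b = a then 1 else if G.Adj a b then 3 else 0

/-- `ψ` is the graph state `|G⟩`: a unit vector fixed by all correlation operators `K_a`. -/
def IsGraphState {n : ℕ} (G : SimpleGraph (Fin n)) [DecidableRel G.Adj] (ψ : QState n) : Prop :=
  qNormSq ψ = 1 ∧ ∀ a : Fin n, Kop G a *ᵥ ψ = ψ

/-- The stabilizer of `ψ`: all signed Pauli operators `g = ±σ` with `g ψ = ψ`. -/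
def stab {n : ℕ} (ψ : QState n) : Set (QOp n) :=
  {g | (∃ f, IsSignedPauli g f) ∧ g *ᵥ ψ = ψ}

/-- The stabilizer elements of weight at most `d`. -/
def stabW {n : ℕ} (ψ : QState n) (d : ℕ) : Set (QOp n) :=
  {g | g ∈ stab ψ ∧ ∃ f, IsSignedPauli g f ∧ pWeight f ≤ d}

/-- `S_d`: the subgroup of the stabilizer generated by all elements of weight at most `d`,
as a set of operators.  (Since the stabilizer is a finite group, the generated submonoid
coincides with the generated subgroup.) -/
def SdSet {n : ℕ} (ψ : QState n) (d : ℕ) : Set (QOp n) :=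
  (Submonoid.closure (stabW ψ d) : Set (QOp n))

/-- `δ(|ψ⟩)`: the minimal weight of a nonidentity element of the stabilizer of `ψ`. -/
def deltaG {n : ℕ} (ψ : QState n) : ℕ :=
  sInf {d | ∃ g ∈ stab ψ, g ≠ 1 ∧ ∃ f, IsSignedPauli g f ∧ pWeight f = d}

/-- `η(|ψ⟩)`: the minimal `d` such that `S_d = S`. -/
def etaG {n : ℕ} (ψ : QState n) : ℕ :=
  sInf {d | stab ψ ⊆ SdSet ψ d}

/-- A `d`-body Hamiltonian on `n` qubits: a real linear combination of Pauli operators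
of weight at most `d`. -/
def IsDBody {n : ℕ} (d : ℕ) (H : QOp n) : Prop :=
  ∃ h : (Fin n → Fin 4) → ℝ, (∀ f, d < pWeight f → h f = 0) ∧
    H = ∑ f : Fin n → Fin 4, (h f : ℂ) • pauliOp f

/-- A Hamiltonian is nontrivial if it is nonzero and not a multiple of the identity. -/
def NontrivialHam {n : ℕ} (H : QOp n) : Prop :=
  H ≠ 0 ∧ ∀ c : ℂ, H ≠ c • (1 : QOp n)

/-- `φ` is an eigenvector of `H` with (real) eigenvalue `E`. -/
def IsEigenpair {n : ℕ} (H : QOp n) (E : ℝ) (φ : QState n) : Prop :=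
  φ ≠ 0 ∧ H *ᵥ φ = (E : ℂ) • φ

/-- `ψ` is a ground state of `H` with ground energy `E`: an eigenvector for the smallest
eigenvalue `E` of `H`. -/
def IsGroundStateE {n : ℕ} (H : QOp n) (ψ : QState n) (E : ℝ) : Prop :=
  IsEigenpair H E ψ ∧ ∀ E' φ, IsEigenpair H E' φ → E ≤ E'

/-- `ψ` is a ground state of `H`. -/
def IsGroundState {n : ℕ} (H : QOp n) (ψ : QState n) : Prop :=
  ∃ E, IsGroundStateE H ψ E

/-- The dimension of the eigenspace of `H` for the eigenvalue `E` (the multiplicity of `E`). -/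
def eigDim {n : ℕ} (H : QOp n) (E : ℝ) : ℕ :=
  Module.finrank ℂ (Module.End.eigenspace (Matrix.mulVecLin H) ((E : ℂ)))

/-- The tensor product of single qubit operators. -/
def tensorOp {n : ℕ} (A : Fin n → Matrix (Fin 2) (Fin 2) ℂ) : QOp n :=
  Matrix.of fun v w => ∏ i, A i (v i) (w i)

lemma tensorOp_mul {n : ℕ} (A B : Fin n → Matrix (Fin 2) (Fin 2) ℂ) :
    tensorOp A * tensorOp B = tensorOp fun i => A i * B i := by
  ext v w
  simp only [tensorOp, Matrix.mul_apply, Matrix.of_apply, ← Finset.prod_mul_distrib]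
  rw [Finset.prod_univ_sum]
  simp

lemma tensorOp_smul {n : ℕ} (c : Fin n → ℂ) (A : Fin n → Matrix (Fin 2) (Fin 2) ℂ) :
    (tensorOp fun i => c i • A i) = (∏ i, c i) • tensorOp A := by
  ext v w
  simp [tensorOp, Finset.prod_mul_distrib]

lemma tensorOp_one {n : ℕ} : (tensorOp fun _ : Fin n => 1) = 1 := by
  ext v w
  simp only [tensorOp, Matrix.of_apply, Matrix.one_apply]
  rw [Fintype.prod_boole]
  simp [funext_iff]

lemma tensorOp_conjTranspose {n : ℕ} (A : Fin n → Matrix (Fin 2) (Fin 2) ℂ) :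
    (tensorOp A)ᴴ = tensorOp fun i => (A i)ᴴ := by
  ext v w
  simp [tensorOp, Matrix.conjTranspose_apply]

lemma pauliOp_eq_tensorOp {n : ℕ} (f : Fin n → Fin 4) :
    pauliOp f = tensorOp fun i => pauli1 (f i) := rfl

lemma pauli1_mul_self (k : Fin 4) : pauli1 k * pauli1 k = 1 := by
  fin_cases k <;> simp [pauli1, Matrix.one_fin_two]

lemma pauli1_conjTranspose (k : Fin 4) : (pauli1 k)ᴴ = pauli1 k := by
  fin_cases k <;> ext i j <;> fin_cases i <;> fin_cases j <;> simp [pauli1]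

lemma pauli1_mul_comm (j k : Fin 4) :
    ∃ c : ℂ, (c = 1 ∨ c = -1) ∧ pauli1 j * pauli1 k = c • (pauli1 k * pauli1 j) := by
  by_cases h : j = 0 ∨ k = 0 ∨ j = k
  · refine ⟨1, Or.inl rfl, ?_⟩
    rcases h with rfl | rfl | rfl <;> simp [pauli1]
  · refine ⟨-1, Or.inr rfl, ?_⟩
    fin_cases j <;> fin_cases k <;> simp [pauli1] at h ⊢

lemma pauliOp_mul_self {n : ℕ} (f : Fin n → Fin 4) : pauliOp f * pauliOp f = 1 := by
  simp only [pauliOp_eq_tensorOp, tensorOp_mul, pauli1_mul_self, tensorOp_one]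

lemma pauliOp_conjTranspose {n : ℕ} (f : Fin n → Fin 4) : (pauliOp f)ᴴ = pauliOp f := by
  simp only [pauliOp_eq_tensorOp, tensorOp_conjTranspose, pauli1_conjTranspose]

/-- Two Pauli operators either commute or anticommute. -/
lemma pauliOp_mul_comm {n : ℕ} (f h : Fin n → Fin 4) :
    pauliOp f * pauliOp h = pauliOp h * pauliOp f ∨
      pauliOp f * pauliOp h = -(pauliOp h * pauliOp f) := by
  choose c hc hcomm using fun i => pauli1_mul_comm (f i) (h i)
  have key : pauliOp f * pauliOp h = (∏ i, c i) • (pauliOp h * pauliOp f) := by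
    simp only [pauliOp_eq_tensorOp, tensorOp_mul, hcomm, tensorOp_smul]
  have hprod : ∏ i, c i = 1 ∨ ∏ i, c i = -1 := by
    refine Finset.prod_induction c (fun x => x = 1 ∨ x = -1) ?_ (Or.inl rfl) fun i _ => hc i
    rintro a b (rfl | rfl) (rfl | rfl) <;> simp
  rcases hprod with h1 | h1 <;> simp [key, h1]

lemma IsSignedPauli.conjTranspose {n : ℕ} {g : QOp n} {f : Fin n → Fin 4}
    (hg : IsSignedPauli g f) : gᴴ = g := by
  rcases hg with rfl | rfl <;> simp [pauliOp_conjTranspose]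

lemma IsSignedPauli.commute_or_anticommute {n : ℕ} {g : QOp n} {h : Fin n → Fin 4}
    (hg : IsSignedPauli g h) (f : Fin n → Fin 4) :
    Commute g (pauliOp f) ∨ g * pauliOp f = -(pauliOp f * g) := by
  rcases hg with rfl | rfl <;> rcases pauliOp_mul_comm h f with e | e <;>
    simp [Commute, SemiconjBy, e]

lemma qInner_mulVec {n : ℕ} (A : QOp n) (φ ψ : QState n) :
    qInner (A *ᵥ φ) ψ = qInner φ (Aᴴ *ᵥ ψ) := by
  change star (A *ᵥ φ) ⬝ᵥ ψ = star φ ⬝ᵥ (Aᴴ *ᵥ ψ)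
  rw [Matrix.star_mulVec, Matrix.dotProduct_mulVec]

lemma qInner_self {n : ℕ} (ψ : QState n) : qInner ψ ψ = qNormSq ψ := by
  simp [qInner, qNormSq, Complex.normSq_eq_conj_mul_self]

lemma qInner_smul_right {n : ℕ} (c : ℂ) (φ ψ : QState n) :
    qInner φ (c • ψ) = c * qInner φ ψ := by
  simp [qInner, Finset.mul_sum, mul_left_comm]

/-- The expectation of `τ` vanishes in a state fixed by a Hermitian operator
anticommuting with `τ`. -/
lemma qInner_eq_zero_of_anticommute {n : ℕ} {A τ : QOp n} {φ : QState n} (hA : Aᴴ = A)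
    (hφ : A *ᵥ φ = φ) (hanti : A * τ = -(τ * A)) : qInner φ (τ *ᵥ φ) = 0 := by
  have h : qInner φ (τ *ᵥ φ) = -qInner φ (τ *ᵥ φ) := by
    calc qInner φ (τ *ᵥ φ) = qInner (A *ᵥ φ) (τ *ᵥ φ) := by rw [hφ]
      _ = qInner φ ((-(τ * A)) *ᵥ φ) := by
        rw [qInner_mulVec, hA, Matrix.mulVec_mulVec, hanti]
      _ = qInner φ ((-1 : ℂ) • (τ *ᵥ φ)) := by
        rw [Matrix.neg_mulVec, ← Matrix.mulVec_mulVec, hφ, neg_one_smul]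
      _ = -qInner φ (τ *ᵥ φ) := by rw [qInner_smul_right, neg_one_mul]
  exact self_eq_neg.mp h

lemma mulVec_eq_of_mem_closure {n : ℕ} {X : Set (QOp n)} {φ : QState n}
    (hX : ∀ x ∈ X, x *ᵥ φ = φ) {x : QOp n} (hx : x ∈ Submonoid.closure X) : x *ᵥ φ = φ := by
  induction hx using Submonoid.closure_induction with
  | mem x hx => exact hX x hx
  | one => exact Matrix.one_mulVec φ
  | mul x y _ _ ihx ihy => rw [← Matrix.mulVec_mulVec, ihy, ihx]

lemma commute_of_mem_closure {n : ℕ} {X : Set (QOp n)} {τ : QOp n}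
    (hX : ∀ x ∈ X, Commute x τ) {x : QOp n} (hx : x ∈ Submonoid.closure X) : Commute x τ := by
  induction hx using Submonoid.closure_induction with
  | mem x hx => exact hX x hx
  | one => exact Commute.one_left τ
  | mul x y _ _ ihx ihy => exact ihx.mul_left ihy

/-- `K_a` connects a bit string only with the string obtained by flipping bit `a`. -/
lemma Kop_apply_eq_zero {n : ℕ} (G : SimpleGraph (Fin n)) [DecidableRel G.Adj] (a : Fin n)
    (v w : Fin n → Fin 2) (x : Fin 2) (hx : x ≠ v a) (hw : w ≠ Function.update v a x) :
    Kop G a v w = 0 := by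
  obtain ⟨i, hi⟩ := Function.ne_iff.mp hw
  simp only [Kop, pauliOp, Matrix.of_apply]
  refine Finset.prod_eq_zero (Finset.mem_univ i) ?_
  by_cases hia : i = a
  · subst hia
    rw [Function.update_self] at hi
    have : w i = v i := by omega
    simp only [if_true, this]
    generalize v i = y
    fin_cases y <;> simp [pauli1]
  · rw [Function.update_of_ne hia] at hi
    simp only [hia, if_false]
    revert hi
    generalize v i = y
    generalize w i = z
    intro hi
    split_ifs <;> fin_cases y <;> fin_cases z <;> simp [pauli1] at hi ⊢

lemma apply_update_eq_zero_of_Kop_fixed {n : ℕ} {G : SimpleGraph (Fin n)} [DecidableRel G.Adj]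
    {φ : QState n} {a : Fin n} (hφ : Kop G a *ᵥ φ = φ) {v : Fin n → Fin 2} (hv : φ v = 0)
    (x : Fin 2) : φ (Function.update v a x) = 0 := by
  by_cases hx : x = v a
  · rwa [hx, Function.update_eq_self]
  rw [← hφ]
  refine Finset.sum_eq_zero fun w _ => ?_
  by_cases hw : w = v
  · rw [hw, hv, mul_zero]
  · exact mul_eq_zero_of_left (Kop_apply_eq_zero G a (Function.update v a x) w (v a)
      (by simpa using Ne.symm hx) (by simpa using hw)) _

lemma eq_zero_of_Kop_fixed {n : ℕ} {G : SimpleGraph (Fin n)} [DecidableRel G.Adj]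
    {φ : QState n} (hφ : ∀ a, Kop G a *ᵥ φ = φ) (h0 : φ 0 = 0) : φ = 0 := by
  have key (v : Fin n → Fin 2) (T : Finset (Fin n)) : φ (T.piecewise v 0) = 0 := by
    induction T using Finset.induction_on with
    | empty => simpa using h0
    | insert a T _ ih =>
      rw [Finset.piecewise_insert]
      exact apply_update_eq_zero_of_Kop_fixed (hφ a) ih (v a)
  funext v
  simpa using key v Finset.univ

/-- The graph state is unique up to a scalar. -/
lemma IsGraphState.exists_smul_of_fixed {n : ℕ} {G : SimpleGraph (Fin n)} [DecidableRel G.Adj]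
    {ψ φ : QState n} (hψ : IsGraphState G ψ) (hφ : ∀ a, Kop G a *ᵥ φ = φ) :
    ∃ c : ℂ, φ = c • ψ := by
  have h0 : ψ 0 ≠ 0 := fun h => by
    have := hψ.1
    rw [eq_zero_of_Kop_fixed hψ.2 h] at this
    simp [qNormSq] at this
  refine ⟨φ 0 / ψ 0, sub_eq_zero.mp (eq_zero_of_Kop_fixed (G := G) (fun a => ?_) ?_)⟩
  · rw [Matrix.mulVec_sub, Matrix.mulVec_smul, hφ, hψ.2]
  · simp [h0]

/-- A Pauli operator commuting with all `K_a` stabilizes the graph state up to a sign. -/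
lemma IsGraphState.pauliOp_mem_stab {n : ℕ} {G : SimpleGraph (Fin n)} [DecidableRel G.Adj]
    {ψ : QState n} (hψ : IsGraphState G ψ) {f : Fin n → Fin 4}
    (hcomm : ∀ a, Commute (Kop G a) (pauliOp f)) :
    pauliOp f ∈ stab ψ ∨ -pauliOp f ∈ stab ψ := by
  obtain ⟨c, hc⟩ := hψ.exists_smul_of_fixed (φ := pauliOp f *ᵥ ψ) fun a => by
    rw [Matrix.mulVec_mulVec, (hcomm a).eq, ← Matrix.mulVec_mulVec, hψ.2]
  have hψ0 : ψ ≠ 0 := by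
    rintro rfl
    simpa [qNormSq] using hψ.1
  have hcc : (c * c) • ψ = (1 : ℂ) • ψ := by
    rw [mul_smul, ← hc, ← Matrix.mulVec_smul, ← hc, Matrix.mulVec_mulVec, pauliOp_mul_self,
      Matrix.one_mulVec, one_smul]
  rcases mul_self_eq_one_iff.mp (smul_left_injective ℂ hψ0 hcc) with rfl | rfl
  · exact Or.inl ⟨⟨f, Or.inl rfl⟩, by rw [hc, one_smul]⟩
  · exact Or.inr ⟨⟨f, Or.inr rfl⟩, by rw [Matrix.neg_mulVec, hc, neg_one_smul, neg_neg]⟩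

/-- let `|G⟩` be an `n`-qubit graph state with stabilizer `S`, `d ≥ 1`, let
`g 0, …, g (s-1)` be independent generators of `S_d` extended to an independent generating
set `g 0, …, g (n-1)` of `S`.  For signs `γ i = ±1` with `γ i = 1` for `i < s`, let `|G;γ⟩`
be the stabilizer state (unit vector) fixed by all `γ i • g i`.  Then for every Pauli
operator `τ = σ_f` of weight at most `d`, `⟨G|τ|G⟩ = ⟨G;γ|τ|G;γ⟩`. -/
theorem expectation_invariant_under_sign_flips
    {n : ℕ} (G : SimpleGraph (Fin n)) [DecidableRel G.Adj]
    (ψ : QState n) (hψ : IsGraphState G ψ)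
    (d : ℕ) (hd : 1 ≤ d) (s : ℕ) (hs : s ≤ n)
    (g : Fin n → QOp n) (hgS : ∀ i, g i ∈ stab ψ)
    (hind : ∀ T : Finset (Fin n), T.Nonempty → ((T.sort (· ≤ ·)).map g).prod ≠ 1)
    (hgen : stab ψ ⊆ (Submonoid.closure (Set.range g) : Set (QOp n)))
    (hSd : SdSet ψ d =
      (Submonoid.closure {x : QOp n | ∃ i : Fin n, (i : ℕ) < s ∧ x = g i} : Set (QOp n)))
    (γ : Fin n → ℂ) (hγ : ∀ i, γ i = 1 ∨ γ i = -1)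
    (hγ1 : ∀ i : Fin n, (i : ℕ) < s → γ i = 1)
    (ψγ : QState n) (hψγn : qNormSq ψγ = 1)
    (hψγ : ∀ i, (γ i • g i) *ᵥ ψγ = ψγ)
    (f : Fin n → Fin 4) (hf : pWeight f ≤ d) :
    qInner ψ (pauliOp f *ᵥ ψ) = qInner ψγ (pauliOp f *ᵥ ψγ) := by
  by_cases hcomm : ∀ i, Commute (g i) (pauliOp f)
  · have hfix {x : QOp n} (hx : x ∈ stab ψ) (hxf : IsSignedPauli x f) : x *ᵥ ψγ = ψγ := by
      have hmem : x ∈ SdSet ψ d := Submonoid.subset_closure ⟨hx, f, hxf, hf⟩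
      rw [hSd] at hmem
      refine mulVec_eq_of_mem_closure ?_ hmem
      rintro _ ⟨i, hi, rfl⟩
      simpa [hγ1 i hi] using hψγ i
    have hK (a : Fin n) : Commute (Kop G a) (pauliOp f) := by
      refine commute_of_mem_closure ?_ (hgen ⟨⟨_, Or.inl rfl⟩, hψ.2 a⟩)
      rintro _ ⟨i, rfl⟩
      exact hcomm i
    have hself : qInner ψ ψ = qInner ψγ ψγ := by
      rw [qInner_self, qInner_self, hψ.1, hψγn]
    rcases hψ.pauliOp_mem_stab hK with h | h
    · rw [h.2, hfix h (Or.inl rfl), hself]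
    · have hneg {φ : QState n} (hφ : (-pauliOp f) *ᵥ φ = φ) : pauliOp f *ᵥ φ = (-1 : ℂ) • φ := by
        rw [neg_one_smul, ← neg_eq_iff_eq_neg, ← Matrix.neg_mulVec, hφ]
      rw [hneg h.2, hneg (hfix h (Or.inr rfl)), qInner_smul_right, qInner_smul_right, hself]
  · obtain ⟨i, hi⟩ := not_forall.mp hcomm
    obtain ⟨⟨k, hk⟩, hgi⟩ := hgS i
    have hanti := (hk.commute_or_anticommute f).resolve_left hi
    have hγstar : star (γ i) = γ i := by rcases hγ i with h | h <;> simp [h]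
    rw [qInner_eq_zero_of_anticommute hk.conjTranspose hgi hanti,
      qInner_eq_zero_of_anticommute (A := γ i • g i) ?_ (hψγ i) ?_]
    · rw [Matrix.conjTranspose_smul, hk.conjTranspose, hγstar]
    · rw [Matrix.smul_mul, hanti, Matrix.mul_smul, smul_neg]
end
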